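/- Let n ≥ 2 and let p be a prime. For any function ψ : ℕ → [0,∞) satisfying ψ(q) = 0 whenever p divides q, the measure μ_p(W_p(ψ, ℚ, n)) is equal to 0 or to 1. -/

import Mathlib

open MeasureTheory

noncomputable section

/-- The p-adic projective distance (at vector level): the sup-norm of the wedge product
divided by the product of sup norms.  Invariant under scaling, it descends to
projective space. -/
def padicDelta (p : ℕ) [Fact p.Prime] {n : ℕ} (x y : Fin n → ℚ_[p]) : ℝ :=
  (⨆ ij : Fin n × Fin n, ‖x ij.1 * y ij.2 - x ij.2 * y ij.1‖) / (‖x‖ * ‖y‖)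

instance (p : ℕ) [Fact p.Prime] (n : ℕ) : MeasurableSpace (Fin n → ℚ_[p]) := borel _
instance (p : ℕ) [Fact p.Prime] (n : ℕ) : BorelSpace (Fin n → ℚ_[p]) := ⟨rfl⟩

/-- `ℤ_p^n` as a positive compact subset of `ℚ_p^n`. -/
def padicUnitPC (p : ℕ) [Fact p.Prime] (n : ℕ) :
    TopologicalSpace.PositiveCompacts (Fin n → ℚ_[p]) where
  carrier := {x | ∀ i, ‖x i‖ ≤ 1}
  isCompact' := by
    have : {x : Fin n → ℚ_[p] | ∀ i, ‖x i‖ ≤ 1} = Set.univ.pi fun _ => Metric.closedBall 0 1 := by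
      ext x; simp [Metric.mem_closedBall, dist_eq_norm]
    rw [this]
    exact isCompact_univ_pi fun i => isCompact_closedBall 0 1
  interior_nonempty' := by
    refine ⟨0, ?_⟩
    rw [mem_interior]
    refine ⟨Metric.ball 0 1, fun x hx i => ?_, Metric.isOpen_ball, by simp⟩
    have hx' : ‖x‖ < 1 := by simpa [dist_eq_norm] using hx
    exact le_of_lt (lt_of_le_of_lt (norm_le_pi_norm x i) hx')

/-- Haar measure on `ℚ_p^n`, normalized so that `ℤ_p^n` has measure one. -/
def padicHaar (p : ℕ) [Fact p.Prime] (n : ℕ) : Measure (Fin n → ℚ_[p]) :=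
  Measure.addHaarMeasure (padicUnitPC p n)

/-- The natural probability measure `μ_p` on `ℙ^{n-1}(ℚ_p)`:
`μ_p(M) = β(φ⁻¹(M) ∩ ℤ_p^n)`. -/
def muP (p : ℕ) [Fact p.Prime] (n : ℕ)
    (M : Set (Projectivization ℚ_[p] (Fin n → ℚ_[p]))) : ENNReal :=
  padicHaar p n {x | (∀ i, ‖x i‖ ≤ 1) ∧ ∃ hx : x ≠ 0, Projectivization.mk ℚ_[p] x hx ∈ M}

/-- A visible (primitive) integer vector: the gcd of its coordinates is 1. -/
def IsPrim {n : ℕ} (v : Fin n → ℤ) : Prop := Finset.univ.gcd v = 1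

/-- The sup-norm height of an integer vector. -/
def Hsup {n : ℕ} (v : Fin n → ℤ) : ℕ := Finset.univ.sup fun i => (v i).natAbs

/-- Embedding of an integer vector into `ℚ_p^n`. -/
def intPadic (p : ℕ) [Fact p.Prime] {n : ℕ} (v : Fin n → ℤ) : Fin n → ℚ_[p] :=
  fun i => ((v i : ℤ) : ℚ_[p])

/-- Embedding of an integer vector into `ℚ^n`. -/
def intRat {n : ℕ} (v : Fin n → ℤ) : Fin n → ℚ := fun i => ((v i : ℤ) : ℚ)

/-- The set `W_p(ψ, ℚ, n)` of points of `ℙ^{n-1}(ℚ_p)` admitting infinitely many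
rational approximations `y` with `δ_p(x,y) ≤ ψ(H(y))`. -/
def Wp (p : ℕ) [Fact p.Prime] (n : ℕ) (ψ : ℕ → ℝ) :
    Set (Projectivization ℚ_[p] (Fin n → ℚ_[p])) :=
  {x | {y : Projectivization ℚ (Fin n → ℚ) | ∃ v : Fin n → ℤ, IsPrim v ∧
      (∃ hv : intRat v ≠ 0, y = Projectivization.mk ℚ (intRat v) hv) ∧
      padicDelta p x.rep (intPadic p v) ≤ ψ (Hsup v)}.Infinite}

/-- Closed ball for the projective metric, centered at the class of the vector `y`. -/
def Bdelta (p : ℕ) [Fact p.Prime] {n : ℕ} (y : Fin n → ℚ_[p]) (r : ℝ) :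
    Set (Projectivization ℚ_[p] (Fin n → ℚ_[p])) :=
  {z | padicDelta p z.rep y ≤ r}

/-- The Euclidean norm of a vector in `ℝ^n`. -/
noncomputable def eNorm {n : ℕ} (x : Fin n → ℝ) : ℝ := Real.sqrt (∑ i, (x i) ^ 2)

/-- Norm of the wedge product of two vectors in `ℝ^n`:
`‖x ∧ y‖² = Σ_{i<j} (x_i y_j − x_j y_i)²`. -/
noncomputable def wedgeNorm {n : ℕ} (x y : Fin n → ℝ) : ℝ :=
  Real.sqrt (∑ ij ∈ Finset.univ.filter (fun ij : Fin n × Fin n => ij.1 < ij.2),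
    (x ij.1 * y ij.2 - x ij.2 * y ij.1) ^ 2)

/-- The projective distance at the infinite place (vector level):
`δ_∞(x,y) = ‖x ∧ y‖ / (‖x‖‖y‖)`. Invariant under scaling, it descends to `ℙ^{n-1}(ℝ)`. -/
noncomputable def deltaInf {n : ℕ} (x y : Fin n → ℝ) : ℝ :=
  wedgeNorm x y / (eNorm x * eNorm y)

/-- Embedding of an integer vector into `ℝ^n`. -/
noncomputable def intReal {n : ℕ} (v : Fin n → ℤ) : Fin n → ℝ := fun i => ((v i : ℤ) : ℝ)

/-- The natural probability measure `μ_∞` on `ℙ^{n-1}(ℝ)`: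
`μ_∞(M) = λ(φ⁻¹(M) ∩ B(0,1)) / λ(B(0,1))`. -/
noncomputable def muInf (n : ℕ) (M : Set (Projectivization ℝ (Fin n → ℝ))) : ENNReal :=
  MeasureTheory.volume {x : Fin n → ℝ | eNorm x ≤ 1 ∧
      ∃ hx : x ≠ 0, Projectivization.mk ℝ x hx ∈ M} /
    MeasureTheory.volume {x : Fin n → ℝ | eNorm x ≤ 1}

/-- The set `W_∞(ψ, ℚ, n)` of points of `ℙ^{n-1}(ℝ)` admitting infinitely many
rational approximations `y` with `δ_∞(x,y) ≤ ψ(H(y))`. -/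
noncomputable def Winf (n : ℕ) (ψ : ℕ → ℝ) : Set (Projectivization ℝ (Fin n → ℝ)) :=
  {x | {y : Projectivization ℚ (Fin n → ℚ) | ∃ v : Fin n → ℤ, IsPrim v ∧
      (∃ hv : intRat v ≠ 0, y = Projectivization.mk ℚ (intRat v) hv) ∧
      deltaInf x.rep (intReal v) ≤ ψ (Hsup v)}.Infinite}

/-- The Choi–Vaaler constant `c(n) = 2·π^{-1/2}·Γ(n/2+1)^{1/n}` for `k = ℚ`. -/
noncomputable def cCV (n : ℕ) : ℝ :=
  2 * Real.pi ^ (-(1/2 : ℝ)) * Real.Gamma ((n : ℝ) / 2 + 1) ^ ((1 : ℝ) / n)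

/-- The Euclidean height of a primitive integer vector. -/
noncomputable def He {n : ℕ} (v : Fin n → ℤ) : ℝ := eNorm (intReal v)

end

open Filter Topology

/-- For `q` large and coprime to `N`, each residue class modulo `N` contains a natural number
at most `q` that is coprime to `q`. -/
theorem exists_coprime_modEq_le {N q : ℕ} (hN : 0 < N) (hq : 2 * (N * primorial N) ≤ q)
    (hNq : N.Coprime q) (r : ℕ) : ∃ a ≤ q, a ≡ r [MOD N] ∧ a.Coprime q := by
  have hq0 : q ≠ 0 := by
    have := primorial_pos N
    have := Nat.mul_pos hN this
    omega
  set w := ∏ l ∈ q.primeFactors with ¬ l ≤ N, l with hw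
  set P := ∏ l ∈ q.primeFactors with l ≤ N, l with hP
  have hPw : P * w ∣ q := by
    rw [hP, hw, Finset.prod_filter_mul_prod_filter_not]
    exact Nat.prod_primeFactors_dvd q
  have hPq : P ∣ q := (Dvd.intro _ rfl).trans hPw
  have hPN : P.Coprime N := (hNq.symm.coprime_dvd_left hPq)
  have hP_le : P ≤ primorial N := by
    rw [hP, primorial]
    apply Finset.prod_le_prod_of_subset_of_one_le'
    · intro l hl
      simp only [Finset.mem_filter, Nat.mem_primeFactors, Finset.mem_range] at hl ⊢
      exact ⟨by omega, hl.1.1⟩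
    · intro l hl _
      simp only [Finset.mem_filter] at hl
      exact hl.2.one_lt.le
  have hP0 : 0 < P := Nat.pos_of_dvd_of_pos hPq (Nat.pos_of_ne_zero hq0)
  have hNle : N ≤ q := by
    have := primorial_pos N
    nlinarith
  have key : ∀ s : ℕ, ∃ t, 1 ≤ t ∧ t ≤ N ∧ t ≡ s [MOD N] := by
    intro s
    refine ⟨if s % N = 0 then N else s % N, ?_⟩
    have := Nat.mod_lt s hN
    split_ifs with h
    · refine ⟨hN, le_rfl, ?_⟩
      simp [Nat.ModEq, h]
    · exact ⟨by omega, this.le, Nat.mod_modEq _ _⟩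
  have hlarge : ∀ {l t : ℕ}, N < l → 1 ≤ t → t ≤ N → ¬ l ∣ t := fun h1 h2 h3 h4 =>
    absurd (Nat.le_of_dvd h2 h4) (by omega)
  rcases (Nat.succ_le_of_lt hP0).eq_or_lt with hP1 | hP1
  · obtain ⟨t, ht1, htN, ht⟩ := key r
    refine ⟨t, htN.trans hNle, ht, Nat.Coprime.symm (Nat.coprime_of_dvd fun l hl hlq hlt => ?_)⟩
    by_cases hlN : l ≤ N
    · have : l ∣ P := Finset.dvd_prod_of_mem _ (by simp [hl, hlq, hlN, hq0])
      rw [← hP1] at this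
      exact hl.one_lt.ne' (Nat.dvd_one.mp this)
    · exact hlarge (by omega) ht1 htN hlt
  · obtain ⟨s, hs⟩ : ∃ s : ℕ, w + s * P ≡ r [MOD N] := by
      have hu : IsUnit (P : ZMod N) := (ZMod.isUnit_iff_coprime _ _).mpr hPN
      have : NeZero N := ⟨hN.ne'⟩
      refine ⟨(((r : ZMod N) - w) * (P : ZMod N)⁻¹).val, ?_⟩
      rw [← ZMod.natCast_eq_natCast_iff]
      push_cast
      rw [ZMod.natCast_zmod_val, mul_assoc, ZMod.inv_mul_of_unit _ hu]
      ring
    obtain ⟨t, ht1, htN, ht⟩ := key s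
    refine ⟨w + t * P, ?_, ((ht.mul_right P).add_left w).trans hs,
      Nat.Coprime.symm (Nat.coprime_of_dvd fun l hl hlq hlt => ?_)⟩
    · have h1 : P * w ≤ q := Nat.le_of_dvd (Nat.pos_of_ne_zero hq0) hPw
      have h2 : t * P ≤ N * primorial N := Nat.mul_le_mul htN hP_le
      nlinarith
    · by_cases hlN : l ≤ N
      · have h1 : l ∣ P := Finset.dvd_prod_of_mem _ (by simp [hl, hlq, hlN, hq0])
        have h2 : l ∣ w := (Nat.dvd_add_left (h1.mul_left t)).mp hlt
        obtain ⟨l', hl', hd⟩ := (hl.prime.dvd_finsetProd_iff _).mp h2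
        simp only [Finset.mem_filter, Nat.mem_primeFactors] at hl'
        rw [(Nat.prime_dvd_prime_iff_eq hl hl'.1.1).mp hd] at hlN
        exact hl'.2 hlN
      · have h1 : l ∣ w := Finset.dvd_prod_of_mem _ (by simp [hl, hlq, hq0]; omega)
        have h2 : l ∣ t * P := (Nat.dvd_add_right h1).mp hlt
        rcases hl.dvd_mul.mp h2 with h3 | h3
        · exact hlarge (by omega) ht1 htN h3
        · obtain ⟨l', hl', hd⟩ := (hl.prime.dvd_finsetProd_iff _).mp h3
          simp only [Finset.mem_filter, Nat.mem_primeFactors] at hl'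
          rw [(Nat.prime_dvd_prime_iff_eq hl hl'.1.1).mp hd] at hlN
          exact hlN hl'.2

section Haar

variable {p : ℕ} [Fact p.Prime] {n : ℕ}

instance : (padicHaar p n).IsAddHaarMeasure := by
  unfold padicHaar; infer_instance

/-- Linear automorphisms scale the Haar measure. -/
theorem exists_padicHaar_image (e : (Fin n → ℚ_[p]) ≃ₗ[ℚ_[p]] (Fin n → ℚ_[p])) :
    ∃ c : NNReal, ∀ S, padicHaar p n (e '' S) = c * padicHaar p n S := by
  have h1 : Continuous e := e.toLinearMap.continuous_of_finiteDimensional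
  have h2 : Continuous e.symm := e.symm.toLinearMap.continuous_of_finiteDimensional
  let f : (Fin n → ℚ_[p]) ≃ᵐ (Fin n → ℚ_[p]) :=
    ⟨e.symm.toEquiv, h2.measurable, h1.measurable⟩
  have : ((padicHaar p n).map f).IsAddHaarMeasure :=
    AddEquiv.isAddHaarMeasure_map (padicHaar p n) e.symm.toAddEquiv h2 h1
  refine ⟨((padicHaar p n).map f).addHaarScalarFactor (padicHaar p n), fun S => ?_⟩
  have h := Measure.isAddLeftInvariant_eq_smul ((padicHaar p n).map f) (padicHaar p n)
  have h3 := congrArg (fun μ => μ S) h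
  simp only [f.map_apply] at h3
  rw [Measure.smul_apply] at h3
  have h4 : f ⁻¹' S = e '' S := (e.toEquiv.image_eq_preimage_symm S).symm
  rw [h4] at h3
  exact h3

theorem padicHaar_unitBall : padicHaar p n {x | ∀ i, ‖x i‖ ≤ 1} = 1 :=
  Measure.addHaarMeasure_self (K₀ := padicUnitPC p n)

theorem setOf_norm_le_one_eq :
    {x : Fin n → ℚ_[p] | ∀ i, ‖x i‖ ≤ 1} = Metric.closedBall 0 1 := by
  ext x
  simp [pi_norm_le_iff_of_nonneg]

/-- Linear automorphisms preserving the norm preserve the Haar measure. -/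
theorem padicHaar_image_of_norm (e : (Fin n → ℚ_[p]) ≃ₗ[ℚ_[p]] (Fin n → ℚ_[p]))
    (he : ∀ x, ‖e x‖ = ‖x‖) (S : Set (Fin n → ℚ_[p])) :
    padicHaar p n (e '' S) = padicHaar p n S := by
  obtain ⟨c, hc⟩ := exists_padicHaar_image e
  have h1 : e '' {x | ∀ i, ‖x i‖ ≤ 1} = {x | ∀ i, ‖x i‖ ≤ 1} := by
    rw [setOf_norm_le_one_eq]
    ext y
    simp only [Set.mem_image, mem_closedBall_zero_iff]
    constructor
    · rintro ⟨x, hx, rfl⟩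
      rwa [he]
    · intro hy
      exact ⟨e.symm y, by rwa [← he, e.apply_symm_apply], e.apply_symm_apply y⟩
  have h2 := hc {x | ∀ i, ‖x i‖ ≤ 1}
  rw [h1, padicHaar_unitBall, mul_one] at h2
  rw [hc, ← h2, one_mul]

/-- Multiplication by a nonzero scalar, as a linear automorphism. -/
noncomputable def scaleEquiv (n : ℕ) (a : ℚ_[p]) (ha : a ≠ 0) :
    (Fin n → ℚ_[p]) ≃ₗ[ℚ_[p]] (Fin n → ℚ_[p]) :=
  LinearEquiv.smulOfNeZero ℚ_[p] _ a ha

theorem scaleEquiv_apply (a : ℚ_[p]) (ha : a ≠ 0) (x : Fin n → ℚ_[p]) :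
    scaleEquiv n a ha x = a • x := rfl

instance : IsUnifLocDoublingMeasure (padicHaar p n) := by
  have hp : (p : ℚ_[p]) ≠ 0 := by exact_mod_cast (Fact.out : p.Prime).ne_zero
  obtain ⟨c, hc⟩ := exists_padicHaar_image (scaleEquiv n (p : ℚ_[p])⁻¹ (inv_ne_zero hp))
  refine ⟨c, ?_⟩
  filter_upwards [self_mem_nhdsWithin] with ε hε x
  have hε' : (0 : ℝ) < ε := hε
  rw [Measure.addHaar_closedBall_center (padicHaar p n) x,
    Measure.addHaar_closedBall_center (padicHaar p n) x, ← hc]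
  refine measure_mono fun y hy => ⟨(p : ℚ_[p]) • y, ?_, ?_⟩
  · rw [mem_closedBall_zero_iff] at hy ⊢
    rw [norm_smul, Padic.norm_p]
    have h2 : (2 : ℝ) ≤ p := by exact_mod_cast (Fact.out : p.Prime).two_le
    rw [inv_mul_le_iff₀ (by linarith)]
    exact hy.trans (by gcongr)
  · rw [scaleEquiv_apply, smul_smul, inv_mul_cancel₀ hp, one_smul]

theorem padicHaar_singleton (hn : n ≠ 0) (x : Fin n → ℚ_[p]) : padicHaar p n {x} = 0 := by
  have : Nonempty (Fin n) := ⟨⟨0, Nat.pos_of_ne_zero hn⟩⟩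
  have : (𝓝[≠] (0 : Fin n → ℚ_[p])).NeBot := Module.punctured_nhds_neBot ℚ_[p] _ 0
  exact measure_singleton x

end Haar

section Distance

variable {p : ℕ} [Fact p.Prime] {n : ℕ}

theorem norm_intPadic_apply_le (v : Fin n → ℤ) (i : Fin n) : ‖intPadic p v i‖ ≤ 1 :=
  Padic.norm_int_le_one _

theorem norm_intPadic_apply_eq_one {v : Fin n → ℤ} {k : Fin n} (h : ¬ p ∣ (v k).natAbs) :
    ‖intPadic p v k‖ = 1 := by
  refine le_antisymm (norm_intPadic_apply_le v k) (not_lt.mp fun hlt => h ?_)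
  exact Int.natCast_dvd.mp (Padic.norm_intCast_lt_one_iff.mp hlt)

theorem norm_intPadic_eq_one {v : Fin n → ℤ} {k : Fin n} (h : ¬ p ∣ (v k).natAbs) :
    ‖intPadic p v‖ = 1 := by
  refine le_antisymm ((pi_norm_le_iff_of_nonneg zero_le_one).mpr (norm_intPadic_apply_le v)) ?_
  rw [← norm_intPadic_apply_eq_one h]
  exact norm_le_pi_norm _ k

theorem padicDelta_le_iff {x y : Fin n → ℚ_[p]} (hx : x ≠ 0) (hy : y ≠ 0) {r : ℝ} (hr : 0 ≤ r) :
    padicDelta p x y ≤ r ↔ ∀ i j, ‖x i * y j - x j * y i‖ ≤ r * (‖x‖ * ‖y‖) := by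
  have hxy : 0 < ‖x‖ * ‖y‖ := mul_pos (norm_pos_iff.mpr hx) (norm_pos_iff.mpr hy)
  rw [padicDelta, div_le_iff₀ hxy]
  constructor
  · intro h i j
    exact (le_ciSup (f := fun ij : Fin n × Fin n => ‖x ij.1 * y ij.2 - x ij.2 * y ij.1‖)
      (Set.finite_range _).bddAbove (i, j)).trans h
  · intro h
    exact Real.iSup_le (fun ij => h ij.1 ij.2) (by positivity)

theorem padicDelta_smul_left {a : ℚ_[p]} (ha : a ≠ 0) (x y : Fin n → ℚ_[p]) :
    padicDelta p (a • x) y = padicDelta p x y := by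
  have ha' : ‖a‖ ≠ 0 := norm_ne_zero_iff.mpr ha
  have h : ∀ ij : Fin n × Fin n, ‖(a • x) ij.1 * y ij.2 - (a • x) ij.2 * y ij.1‖
      = ‖a‖ * ‖x ij.1 * y ij.2 - x ij.2 * y ij.1‖ := fun ij => by
    rw [← norm_mul]
    congr 1
    simp only [Pi.smul_apply, smul_eq_mul]
    ring
  simp only [padicDelta, h, norm_smul]
  rw [← Real.mul_iSup_of_nonneg (norm_nonneg a), mul_assoc, mul_div_mul_left _ _ ha']

theorem padicDelta_rep_mk {x : Fin n → ℚ_[p]} (hx : x ≠ 0) (y : Fin n → ℚ_[p]) :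
    padicDelta p (Projectivization.mk ℚ_[p] x hx).rep y = padicDelta p x y := by
  obtain ⟨a, ha⟩ := Projectivization.exists_smul_eq_mk_rep ℚ_[p] x hx
  rw [← ha]
  exact padicDelta_smul_left a.ne_zero x y

theorem norm_sub_le_max_ultra {E : Type*} [SeminormedAddCommGroup E] [IsUltrametricDist E]
    (x y : E) : ‖x - y‖ ≤ max ‖x‖ ‖y‖ := by
  rw [sub_eq_add_neg, ← norm_neg y]
  exact IsUltrametricDist.norm_add_le_max _ _

theorem norm_eq_of_norm_sub_lt {E : Type*} [SeminormedAddCommGroup E] [IsUltrametricDist E]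
    {x y : E} (h : ‖x - y‖ < ‖y‖) : ‖x‖ = ‖y‖ := by
  refine le_antisymm ?_ ?_
  · calc ‖x‖ = ‖(x - y) + y‖ := by rw [sub_add_cancel]
      _ ≤ max ‖x - y‖ ‖y‖ := IsUltrametricDist.norm_add_le_max _ _
      _ = ‖y‖ := max_eq_right h.le
  · by_contra! hlt
    have h1 : ‖y‖ ≤ max ‖x‖ ‖x - y‖ := by
      calc ‖y‖ = ‖x - (x - y)‖ := by rw [sub_sub_cancel]
        _ ≤ _ := norm_sub_le_max_ultra _ _
    exact absurd h1 (not_le.mpr (max_lt hlt h))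

/-- Near a vector of norm one, the projective distance measures the distance to the unit
multiples of the vector. -/
theorem padicDelta_le_iff_exists_unit {x y : Fin n → ℚ_[p]} {k : Fin n} (hx : ‖x‖ = 1)
    (hy : ‖y‖ = 1) (hyk : ‖y k‖ = 1) {r : ℝ} (hr0 : 0 ≤ r) (hr1 : r < 1) :
    padicDelta p x y ≤ r ↔ ∃ u : ℚ_[p], ‖u‖ = 1 ∧ ‖x - u • y‖ ≤ r := by
  have hx0 : x ≠ 0 := norm_ne_zero_iff.mp (by rw [hx]; exact one_ne_zero)
  have hy0 : y ≠ 0 := norm_ne_zero_iff.mp (by rw [hy]; exact one_ne_zero)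
  have hyk0 : y k ≠ 0 := norm_ne_zero_iff.mp (by rw [hyk]; exact one_ne_zero)
  rw [padicDelta_le_iff hx0 hy0 hr0, hx, hy, mul_one, mul_one]
  constructor
  · intro h
    have hle : ‖x - (x k / y k) • y‖ ≤ r := by
      refine (pi_norm_le_iff_of_nonneg hr0).mpr fun j => ?_
      have : (x - (x k / y k) • y) j = (x j * y k - x k * y j) / y k := by
        simp only [Pi.sub_apply, Pi.smul_apply, smul_eq_mul]
        field_simp
      rw [this, norm_div, hyk, div_one]
      exact h j k
    refine ⟨x k / y k, ?_, hle⟩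
    have h1 : ‖(x k / y k) • y - x‖ < ‖x‖ := by
      rw [norm_sub_rev, hx]
      exact hle.trans_lt hr1
    have h2 := norm_eq_of_norm_sub_lt h1
    rwa [norm_smul, hy, mul_one, hx] at h2
  · rintro ⟨u, -, hu⟩ i j
    have hyle : ∀ i, ‖y i‖ ≤ 1 := fun i => hy ▸ norm_le_pi_norm y i
    have hz : ∀ i, ‖(x - u • y) i‖ ≤ r := fun i => (norm_le_pi_norm _ i).trans hu
    have : x i * y j - x j * y i = (x - u • y) i * y j - (x - u • y) j * y i := by
      simp only [Pi.sub_apply, Pi.smul_apply, smul_eq_mul]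
      ring
    rw [this]
    refine (norm_sub_le_max_ultra _ _).trans (max_le ?_ ?_) <;> rw [norm_mul]
    · exact (mul_le_mul (hz i) (hyle j) (norm_nonneg _) hr0).trans_eq (mul_one r)
    · exact (mul_le_mul (hz j) (hyle i) (norm_nonneg _) hr0).trans_eq (mul_one r)

end Distance

section Heights

variable {n : ℕ}

theorem natAbs_le_Hsup (v : Fin n → ℤ) (i : Fin n) : (v i).natAbs ≤ Hsup v :=
  Finset.le_sup (f := fun i => (v i).natAbs) (Finset.mem_univ i)

theorem exists_natAbs_eq_Hsup (hn : n ≠ 0) (v : Fin n → ℤ) : ∃ k, (v k).natAbs = Hsup v := by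
  have : (Finset.univ : Finset (Fin n)).Nonempty := ⟨⟨0, Nat.pos_of_ne_zero hn⟩, Finset.mem_univ _⟩
  obtain ⟨k, -, hk⟩ := Finset.exists_mem_eq_sup Finset.univ this fun i => (v i).natAbs
  exact ⟨k, hk.symm⟩

theorem Hsup_eq_of_forall_le {v : Fin n → ℤ} {q : ℕ} {k : Fin n} (hk : (v k).natAbs = q)
    (h : ∀ i, (v i).natAbs ≤ q) : Hsup v = q :=
  le_antisymm (Finset.sup_le fun i _ => h i) (hk ▸ natAbs_le_Hsup v k)

theorem finite_setOf_Hsup_eq (q : ℕ) : {v : Fin n → ℤ | Hsup v = q}.Finite := by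
  refine (Set.finite_Icc (fun _ => -(q : ℤ)) (fun _ => (q : ℤ))).subset fun v hv => ?_
  have h : ∀ i, (v i).natAbs ≤ q := fun i => (natAbs_le_Hsup v i).trans_eq hv
  exact ⟨fun i => by have := h i; show -(q : ℤ) ≤ v i; omega,
    fun i => by have := h i; show v i ≤ (q : ℤ); omega⟩

theorem IsPrim.intRat_ne_zero {v : Fin n → ℤ} (hv : IsPrim v) : intRat v ≠ 0 := by
  intro h
  have h0 : v = 0 := funext fun i => by
    have := congrFun h i
    simpa [intRat] using this
  rw [IsPrim, h0] at hv
  have : (Finset.univ : Finset (Fin n)).gcd (0 : Fin n → ℤ) = 0 :=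
    Finset.gcd_eq_zero_iff.mpr fun _ _ => rfl
  rw [this] at hv
  exact zero_ne_one hv

theorem IsPrim.of_gcd_dvd {v w : Fin n → ℤ} (hv : IsPrim v)
    (h : Finset.univ.gcd w ∣ Finset.univ.gcd v) : IsPrim w := by
  rw [show Finset.univ.gcd v = 1 from hv] at h
  rw [IsPrim, ← Finset.normalize_gcd]
  exact normalize_eq_one.mpr (isUnit_of_dvd_one h)

/-- Proportional primitive vectors have the same height. -/
theorem IsPrim.Hsup_eq {v w : Fin n → ℤ} (hv : IsPrim v) (hw : IsPrim w)
    (h : Projectivization.mk ℚ (intRat v) hv.intRat_ne_zero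
      = Projectivization.mk ℚ (intRat w) hw.intRat_ne_zero) : Hsup v = Hsup w := by
  obtain ⟨a, ha⟩ := (Projectivization.mk_eq_mk_iff' ℚ _ _ _ _).mp h
  have hi : ∀ i, a.num * w i = a.den * v i := fun i => by
    have h1 := congrFun ha i
    simp only [intRat, Pi.smul_apply, smul_eq_mul] at h1
    have hd : (a.den : ℚ) ≠ 0 := by exact_mod_cast a.den_ne_zero
    rw [← Rat.num_div_den a, div_mul_eq_mul_div, div_eq_iff hd] at h1
    have h2 : (a.num : ℚ) * w i = a.den * v i := by rw [h1, mul_comm]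
    exact_mod_cast h2
  have hg : (Finset.univ.gcd fun i => a.num * w i) = Finset.univ.gcd fun i => (a.den : ℤ) * v i :=
    Finset.gcd_congr rfl fun i _ => hi i
  rw [Finset.gcd_mul_left, Finset.gcd_mul_left, show Finset.univ.gcd w = 1 from hw,
    show Finset.univ.gcd v = 1 from hv, mul_one, mul_one] at hg
  have hab : a.num.natAbs = a.den := by
    have := congrArg Int.natAbs hg
    simpa [← Int.abs_eq_normalize, Int.natAbs_abs] using this
  refine Finset.sup_congr rfl fun i _ => ?_
  have h3 := congrArg Int.natAbs (hi i)
  rw [Int.natAbs_mul, Int.natAbs_mul, hab, Int.natAbs_natCast] at h3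
  exact (Nat.eq_of_mul_eq_mul_left a.den_pos h3).symm

end Heights

section ChartLimsup

variable {p : ℕ} [Fact p.Prime] {n : ℕ}

/-- The `p`-adic unit multiples of the primitive integer vectors of height `q` whose height is
attained at the coordinate `k`. -/
def unitMultiples (p : ℕ) [Fact p.Prime] {n : ℕ} (k : Fin n) (q : ℕ) : Set (Fin n → ℚ_[p]) :=
  {x | ∃ (v : Fin n → ℤ) (u : ℚ_[p]), IsPrim v ∧ Hsup v = q ∧ (v k).natAbs = q ∧ ‖u‖ = 1 ∧
    x = u • intPadic p v}

/-- The vectors within distance `ψ q` of `unitMultiples p k q` for infinitely many `q` prime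
to `p`. -/
def chartLimsup (p : ℕ) [Fact p.Prime] {n : ℕ} (k : Fin n) (ψ : ℕ → ℝ) :
    Set (Fin n → ℚ_[p]) :=
  blimsup (fun q => Metric.cthickening (ψ q) (unitMultiples p k q)) atTop fun q => ¬ p ∣ q

theorem isCompact_unitMultiples (k : Fin n) (q : ℕ) : IsCompact (unitMultiples p k q) := by
  have h : unitMultiples p k q =
      ⋃ v ∈ {v : Fin n → ℤ | Hsup v = q ∧ IsPrim v ∧ (v k).natAbs = q},
        (fun u : ℚ_[p] => u • intPadic p v) '' Metric.sphere 0 1 := by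
    ext x
    simp only [unitMultiples, Set.mem_ofPred_eq, Set.mem_iUnion, Set.mem_image,
      mem_sphere_zero_iff_norm, exists_prop]
    constructor
    · rintro ⟨v, u, h1, h2, h3, h4, rfl⟩
      exact ⟨v, ⟨h2, h1, h3⟩, u, h4, rfl⟩
    · rintro ⟨v, ⟨h2, h1, h3⟩, u, h4, rfl⟩
      exact ⟨v, u, h1, h2, h3, h4, rfl⟩
  rw [h]
  refine ((finite_setOf_Hsup_eq q).subset fun v hv => hv.1).isCompact_biUnion fun v _ => ?_
  exact (isCompact_sphere 0 1).image (continuous_id.smul continuous_const)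

theorem mem_chartLimsup {k : Fin n} {ψ : ℕ → ℝ} (hψ : ∀ q, 0 ≤ ψ q) {x : Fin n → ℚ_[p]} :
    x ∈ chartLimsup p k ψ ↔ ∃ᶠ q in atTop, ¬ p ∣ q ∧ ∃ (v : Fin n → ℤ) (u : ℚ_[p]),
      IsPrim v ∧ Hsup v = q ∧ (v k).natAbs = q ∧ ‖u‖ = 1 ∧ ‖x - u • intPadic p v‖ ≤ ψ q := by
  rw [Nat.frequently_atTop_iff_infinite, chartLimsup, ← Nat.cofinite_eq_atTop,
    cofinite.blimsup_set_eq, Set.mem_ofPred_eq]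
  refine iff_of_eq (congrArg Set.Infinite (Set.ext fun q => and_congr_right fun _ => ?_))
  rw [(isCompact_unitMultiples k q).cthickening_eq_biUnion_closedBall (hψ q)]
  simp only [Set.mem_iUnion, exists_prop, mem_closedBall_iff_norm]
  constructor
  · rintro ⟨_, ⟨v, u, h1, h2, h3, h4, rfl⟩, hx⟩
    exact ⟨v, u, h1, h2, h3, h4, hx⟩
  · rintro ⟨v, u, h1, h2, h3, h4, hx⟩
    exact ⟨_, ⟨v, u, h1, h2, h3, h4, rfl⟩, hx⟩

theorem measurableSet_chartLimsup (k : Fin n) (ψ : ℕ → ℝ) :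
    MeasurableSet (chartLimsup p k ψ) :=
  MeasurableSet.measurableSet_blimsup fun _ _ => Metric.isClosed_cthickening.measurableSet

/-- Rescaling the radii by a constant does not change the limsup set up to null sets. -/
theorem chartLimsup_const_mul_ae_eq (k : Fin n) {ψ : ℕ → ℝ} (hψ : Tendsto ψ atTop (𝓝 0))
    {M : ℝ} (hM : 0 < M) :
    chartLimsup p k (fun q => M * ψ q) =ᵐ[padicHaar p n] chartLimsup p k ψ :=
  blimsup_cthickening_mul_ae_eq _ _ _ hM _ hψ

end ChartLimsup

section Charts

variable {p : ℕ} [Fact p.Prime] {n : ℕ}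

theorem prime_cast_ne_zero : (p : ℚ_[p]) ≠ 0 := by
  exact_mod_cast (Fact.out : p.Prime).ne_zero

theorem zpow_neg_pos (m : ℕ) : 0 < (p : ℝ) ^ (-(m : ℤ)) :=
  zpow_pos (by exact_mod_cast (Fact.out : p.Prime).pos) _

theorem zpow_neg_lt_one {m : ℕ} (hm : m ≠ 0) : (p : ℝ) ^ (-(m : ℤ)) < 1 :=
  zpow_lt_one_of_neg₀ (by exact_mod_cast (Fact.out : p.Prime).one_lt) (by omega)

theorem tendsto_zpow_neg : Tendsto (fun m : ℕ => (p : ℝ) ^ (-(m : ℤ))) atTop (𝓝[>] 0) := by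
  refine tendsto_nhdsWithin_iff.mpr ⟨?_, Eventually.of_forall fun m => zpow_neg_pos m⟩
  have h1 : (1 : ℝ) < p := by exact_mod_cast (Fact.out : p.Prime).one_lt
  have h := tendsto_pow_atTop_nhds_zero_of_lt_one (r := (p : ℝ)⁻¹) (by positivity)
    (inv_lt_one_of_one_lt₀ h1)
  refine h.congr fun m => ?_
  rw [zpow_neg, zpow_natCast, inv_pow]

theorem exists_natCast_norm_sub_le {z : ℚ_[p]} (hz : ‖z‖ ≤ 1) (m : ℕ) :
    ∃ c < p ^ m, ‖z - (c : ℚ_[p])‖ ≤ (p : ℝ) ^ (-(m : ℤ)) := by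
  let w : ℤ_[p] := ⟨z, hz⟩
  refine ⟨w.appr m, w.appr_lt m, ?_⟩
  have h := (PadicInt.norm_le_pow_iff_mem_span_pow _ m).mpr (PadicInt.appr_spec m w)
  rw [PadicInt.norm_def] at h
  rwa [PadicInt.coe_sub, PadicInt.coe_natCast] at h

theorem norm_natCast_le_one (c : ℕ) : ‖(c : ℚ_[p])‖ ≤ 1 := by
  exact_mod_cast Padic.norm_int_le_one (c : ℤ)

/-- The vectors of norm one whose norm is attained at the coordinate `k`. -/
def unitChart (p : ℕ) [Fact p.Prime] {n : ℕ} (k : Fin n) : Set (Fin n → ℚ_[p]) :=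
  {x | ‖x k‖ = 1 ∧ ‖x‖ ≤ 1}

/-- The integral vectors whose coordinate `k` is close to `t`. -/
def slab (p : ℕ) [Fact p.Prime] {n : ℕ} (k : Fin n) (t : ℚ_[p]) (m : ℕ) :
    Set (Fin n → ℚ_[p]) :=
  {x | ‖x k - t‖ ≤ (p : ℝ) ^ (-(m : ℤ)) ∧ ∀ j, j ≠ k → ‖x j‖ ≤ 1}

theorem measurableSet_slab (k : Fin n) (t : ℚ_[p]) (m : ℕ) : MeasurableSet (slab p k t m) := by
  have h : IsClosed (slab p k t m) := by
    have h1 : IsClosed {x : Fin n → ℚ_[p] | ‖x k - t‖ ≤ (p : ℝ) ^ (-(m : ℤ))} :=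
      isClosed_le (by fun_prop) continuous_const
    have h2 : IsClosed {x : Fin n → ℚ_[p] | ∀ j, j ≠ k → ‖x j‖ ≤ 1} := by
      simp only [Set.ofPred_forall]
      exact isClosed_iInter fun j => isClosed_iInter fun _ =>
        isClosed_le (by fun_prop) continuous_const
    exact h1.inter h2
  exact h.measurableSet

theorem smul_mem_slab {k : Fin n} {t u : ℚ_[p]} (hu : ‖u‖ = 1) {m : ℕ} {x : Fin n → ℚ_[p]}
    (hx : x ∈ slab p k t m) : u • x ∈ slab p k (u * t) m := by
  refine ⟨?_, fun j hj => ?_⟩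
  · rw [Pi.smul_apply, smul_eq_mul, ← mul_sub, norm_mul, hu, one_mul]
    exact hx.1
  · rw [Pi.smul_apply, smul_eq_mul, norm_mul, hu, one_mul]
    exact hx.2 j hj

theorem unitChart_eq_biUnion_slab (k : Fin n) {m : ℕ} (hm : m ≠ 0) :
    unitChart p k = ⋃ i ∈ (Finset.range (p ^ m)).filter (¬ p ∣ ·), slab p k (i : ℚ_[p]) m := by
  ext x
  simp only [Finset.mem_filter, Finset.mem_range, Set.mem_iUnion, exists_prop]
  constructor
  · rintro ⟨hk, hx⟩
    obtain ⟨c, hc, hxc⟩ := exists_natCast_norm_sub_le (z := x k) hk.le m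
    refine ⟨c, ⟨hc, fun hpc => ?_⟩, hxc, fun j _ => (norm_le_pi_norm x j).trans hx⟩
    have h1 := norm_eq_of_norm_sub_lt (x := (c : ℚ_[p])) (y := x k) (by
      rw [norm_sub_rev, hk]
      exact hxc.trans_lt (zpow_neg_lt_one hm))
    exact absurd (Padic.norm_natCast_lt_one_iff.mpr hpc) (by rw [h1, hk]; exact lt_irrefl 1)
  · rintro ⟨i, ⟨-, hi⟩, hx1, hx2⟩
    have h1 : ‖(i : ℚ_[p])‖ = 1 :=
      le_antisymm (norm_natCast_le_one i) (not_lt.mp (mt Padic.norm_natCast_lt_one_iff.mp hi))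
    have h2 : ‖x k‖ = 1 := by
      rw [← h1]
      exact norm_eq_of_norm_sub_lt (by rw [h1]; exact hx1.trans_lt (zpow_neg_lt_one hm))
    refine ⟨h2, (pi_norm_le_iff_of_nonneg zero_le_one).mpr fun j => ?_⟩
    by_cases hj : j = k
    · rw [hj, h2]
    · exact hx2 j hj

theorem padicHaar_inter_slab_eq {E : Set (Fin n → ℚ_[p])}
    (hE : ∀ u : ℚ_[p], ‖u‖ = 1 → ∀ x ∈ E, u • x ∈ E) (k : Fin n) {s t : ℚ_[p]} (hs : ‖s‖ = 1)
    (ht : ‖t‖ = 1) (m : ℕ) :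
    padicHaar p n (E ∩ slab p k s m) = padicHaar p n (E ∩ slab p k t m) := by
  have hs0 : s ≠ 0 := norm_ne_zero_iff.mp (by rw [hs]; exact one_ne_zero)
  have ht0 : t ≠ 0 := norm_ne_zero_iff.mp (by rw [ht]; exact one_ne_zero)
  have hu : ‖t / s‖ = 1 := by rw [norm_div, hs, ht, div_one]
  have hu' : ‖s / t‖ = 1 := by rw [norm_div, hs, ht, div_one]
  rw [← padicHaar_image_of_norm (scaleEquiv n (t / s) (div_ne_zero ht0 hs0))
    (fun x => by rw [scaleEquiv_apply, norm_smul, hu, one_mul]) (E ∩ slab p k s m)]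
  congr 1
  ext x
  constructor
  · rintro ⟨y, ⟨hy1, hy2⟩, rfl⟩
    refine ⟨hE _ hu y hy1, ?_⟩
    have := smul_mem_slab hu hy2
    rwa [div_mul_cancel₀ _ hs0] at this
  · rintro ⟨hx1, hx2⟩
    refine ⟨(s / t) • x, ⟨hE _ hu' x hx1, ?_⟩, ?_⟩
    · have := smul_mem_slab hu' hx2
      rwa [div_mul_cancel₀ _ ht0] at this
    · rw [scaleEquiv_apply, smul_smul, div_mul_div_cancel₀ hs0, div_self ht0, one_smul]

/-- A measurable set invariant under `p`-adic units is evenly distributed over the slabs. -/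
theorem padicHaar_inter_unitChart {E : Set (Fin n → ℚ_[p])} (hEm : MeasurableSet E)
    (hE : ∀ u : ℚ_[p], ‖u‖ = 1 → ∀ x ∈ E, u • x ∈ E) (k : Fin n) {t : ℚ_[p]} (ht : ‖t‖ = 1)
    {m : ℕ} (hm : m ≠ 0) :
    padicHaar p n (E ∩ unitChart p k) =
      ((Finset.range (p ^ m)).filter (¬ p ∣ ·)).card * padicHaar p n (E ∩ slab p k t m) := by
  rw [unitChart_eq_biUnion_slab k hm, Set.inter_iUnion₂, measure_biUnion_finset]
  · rw [Finset.sum_congr rfl (g := fun _ => padicHaar p n (E ∩ slab p k t m)),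
      Finset.sum_const, nsmul_eq_mul]
    intro i hi
    refine padicHaar_inter_slab_eq hE k ?_ ht m
    exact le_antisymm (norm_natCast_le_one i)
      (not_lt.mp (mt Padic.norm_natCast_lt_one_iff.mp (Finset.mem_filter.mp hi).2))
  · intro i hi j hj hij
    refine Set.disjoint_left.mpr fun x hxi hxj => hij ?_
    have h1 : ‖(((i : ℤ) - (j : ℤ) : ℤ) : ℚ_[p])‖ ≤ (p : ℝ) ^ (-(m : ℤ)) := by
      have : (((i : ℤ) - (j : ℤ) : ℤ) : ℚ_[p]) = (x k - j) - (x k - i) := by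
        push_cast
        ring
      rw [this]
      exact (norm_sub_le_max_ultra _ _).trans (max_le hxj.2.1 hxi.2.1)
    have h2 := (Padic.norm_int_le_pow_iff_dvd _ m).mp h1
    have h3 : (i : ℤ) ≡ j [ZMOD ((p ^ m : ℕ) : ℤ)] := by
      refine (Int.modEq_iff_dvd.mpr ?_).symm
      exact_mod_cast h2
    have hi' := Finset.mem_range.mp (Finset.mem_filter.mp hi).1
    have hj' := Finset.mem_range.mp (Finset.mem_filter.mp hj).1
    exact (Int.natCast_modEq_iff.mp h3).eq_of_lt_of_lt hi' hj'
  · exact fun i _ => hEm.inter (measurableSet_slab k _ m)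

theorem smul_mem_chartLimsup {k : Fin n} {ψ : ℕ → ℝ} (hψ : ∀ q, 0 ≤ ψ q) {u : ℚ_[p]}
    (hu : ‖u‖ = 1) {x : Fin n → ℚ_[p]} (hx : x ∈ chartLimsup p k ψ) :
    u • x ∈ chartLimsup p k ψ := by
  rw [mem_chartLimsup hψ] at hx ⊢
  refine hx.mono ?_
  rintro q ⟨hq, v, w, h1, h2, h3, h4, h5⟩
  refine ⟨hq, v, u * w, h1, h2, h3, by rw [norm_mul, hu, h4, one_mul], ?_⟩
  rwa [mul_smul, ← smul_sub, norm_smul, hu, one_mul]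

theorem chartLimsup_subset_unitChart {k : Fin n} {ψ : ℕ → ℝ} (hψ : ∀ q, 0 ≤ ψ q)
    (hψ0 : Tendsto ψ atTop (𝓝 0)) : chartLimsup p k ψ ⊆ unitChart p k := by
  intro x hx
  rw [mem_chartLimsup hψ] at hx
  obtain ⟨q, ⟨hq, v, u, h1, h2, h3, h4, h5⟩, hq1⟩ :=
    (hx.and_eventually (hψ0.eventually_lt_const zero_lt_one)).exists
  have hvk : ¬ p ∣ (v k).natAbs := by rwa [h3]
  have e1 : ‖u • intPadic p v‖ = 1 := by rw [norm_smul, h4, norm_intPadic_eq_one hvk, one_mul]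
  have e2 : ‖(u • intPadic p v) k‖ = 1 := by
    rw [Pi.smul_apply, norm_smul, h4, norm_intPadic_apply_eq_one hvk, one_mul]
  have h6 := h5.trans_lt hq1
  refine ⟨?_, ?_⟩
  · rw [← e2]
    refine norm_eq_of_norm_sub_lt ?_
    rw [e2]
    exact (norm_le_pi_norm (x - u • intPadic p v) k).trans_lt h6
  · exact (norm_eq_of_norm_sub_lt (by rwa [e1])).trans_le e1.le

/-- The linear automorphism fixing the coordinate `k` and sending each other coordinate `x j` to
`(x j - c j * x k) / P`. -/
noncomputable def shearEquiv (k : Fin n) (c : Fin n → ℚ_[p]) (P : ℚ_[p]) (hP : P ≠ 0) :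
    (Fin n → ℚ_[p]) ≃ₗ[ℚ_[p]] (Fin n → ℚ_[p]) where
  toFun x j := if j = k then x k else P⁻¹ * (x j - c j * x k)
  map_add' x y := by
    ext j
    by_cases h : j = k <;> simp [h]
    ring
  map_smul' a x := by
    ext j
    by_cases h : j = k <;> simp [h]
    ring
  invFun y j := if j = k then y k else P * y j + c j * y k
  left_inv x := by
    ext j
    by_cases h : j = k <;> simp [h, hP]
  right_inv y := by
    ext j
    by_cases h : j = k <;> simp [h, hP]

theorem shearEquiv_apply_same (k : Fin n) (c : Fin n → ℚ_[p]) {P : ℚ_[p]} (hP : P ≠ 0)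
    (x : Fin n → ℚ_[p]) : shearEquiv k c P hP x k = x k := if_pos rfl

theorem shearEquiv_apply_of_ne {k j : Fin n} (h : j ≠ k) (c : Fin n → ℚ_[p]) {P : ℚ_[p]}
    (hP : P ≠ 0) (x : Fin n → ℚ_[p]) : shearEquiv k c P hP x j = P⁻¹ * (x j - c j * x k) :=
  if_neg h

theorem norm_shearEquiv_le (k : Fin n) {c : Fin n → ℚ_[p]} (hc : ∀ j, ‖c j‖ ≤ 1) {m : ℕ}
    (hP : (p : ℚ_[p]) ^ m ≠ 0) (x : Fin n → ℚ_[p]) :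
    ‖shearEquiv k c _ hP x‖ ≤ (p : ℝ) ^ m * ‖x‖ := by
  have h1 : (1 : ℝ) ≤ (p : ℝ) ^ m :=
    one_le_pow₀ (by exact_mod_cast (Fact.out : p.Prime).one_le)
  refine (pi_norm_le_iff_of_nonneg (by positivity)).mpr fun j => ?_
  by_cases hj : j = k
  · rw [hj, shearEquiv_apply_same]
    exact (norm_le_pi_norm x k).trans (le_mul_of_one_le_left (norm_nonneg x) h1)
  · rw [shearEquiv_apply_of_ne hj, norm_mul, norm_inv, norm_pow, Padic.norm_p, inv_pow, inv_inv]
    refine mul_le_mul_of_nonneg_left ?_ (by positivity)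
    refine (norm_sub_le_max_ultra _ _).trans (max_le (norm_le_pi_norm x j) ?_)
    rw [norm_mul]
    exact (mul_le_mul (hc j) (norm_le_pi_norm x k) (norm_nonneg _) zero_le_one).trans_eq
      (one_mul _)

theorem norm_inv_pow_mul_le_one_iff (m : ℕ) (z : ℚ_[p]) :
    ‖((p : ℚ_[p]) ^ m)⁻¹ * z‖ ≤ 1 ↔ ‖z‖ ≤ (p : ℝ) ^ (-(m : ℤ)) := by
  have h : (0 : ℝ) < (p : ℝ) ^ m := pow_pos (by exact_mod_cast (Fact.out : p.Prime).pos) m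
  rw [norm_mul, norm_inv, norm_pow, Padic.norm_p, inv_pow, inv_inv, zpow_neg, zpow_natCast,
    ← le_inv_mul_iff₀ h, mul_one]

/-- Contracted shears with suitable integer coefficients map approximable vectors to approximable
vectors, multiplying the radii by `p ^ m`. -/
theorem shearEquiv_mem_chartLimsup {k : Fin n} {ψ : ℕ → ℝ} (hψ : ∀ q, 0 ≤ ψ q)
    (hψ0 : Tendsto ψ atTop (𝓝 0)) {m : ℕ} {c : Fin n → ℕ} (hc : ∀ j, c j < p ^ m)
    (hP : (p : ℚ_[p]) ^ m ≠ 0) {x : Fin n → ℚ_[p]} (hx : x ∈ chartLimsup p k ψ)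
    (hxc : ∀ j, j ≠ k → ‖x j - c j * x k‖ ≤ (p : ℝ) ^ (-(m : ℤ))) :
    shearEquiv k (fun j => (c j : ℚ_[p])) _ hP x ∈ chartLimsup p k fun q => (p : ℝ) ^ m * ψ q := by
  rw [mem_chartLimsup fun q => mul_nonneg (by positivity) (hψ q)]
  rw [mem_chartLimsup hψ] at hx
  refine (hx.and_eventually (hψ0.eventually_lt_const (zpow_neg_pos (p := p) m))).mono ?_
  rintro q ⟨⟨hq, v, u, h1, h2, h3, h4, h5⟩, hqm⟩
  have hcast : ∀ j, ((v j - c j * v k : ℤ) : ℚ_[p]) = intPadic p v j - c j * intPadic p v k :=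
    fun j => by simp [intPadic]
  have hdvd : ∀ j, j ≠ k → ((p ^ m : ℕ) : ℤ) ∣ v j - c j * v k := by
    intro j hj
    push_cast
    rw [← Padic.norm_int_le_pow_iff_dvd, hcast, ← one_mul ‖_‖, ← h4, ← norm_mul]
    set z := x - u • intPadic p v with hz
    have hzle : ∀ i, ‖z i‖ ≤ (p : ℝ) ^ (-(m : ℤ)) := fun i =>
      (norm_le_pi_norm z i).trans (h5.trans hqm.le)
    have e : u * (intPadic p v j - c j * intPadic p v k)
        = (x j - c j * x k) - (z j - c j * z k) := by
      simp only [hz, Pi.sub_apply, Pi.smul_apply, smul_eq_mul]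
      ring
    rw [e]
    refine (norm_sub_le_max_ultra _ _).trans (max_le (hxc j hj) ?_)
    refine (norm_sub_le_max_ultra _ _).trans (max_le (hzle j) ?_)
    rw [norm_mul]
    exact (mul_le_of_le_one_left (norm_nonneg _) (norm_natCast_le_one _)).trans (hzle k)
  let w : Fin n → ℤ := fun j => if j = k then v k else (v j - c j * v k) / (p ^ m : ℕ)
  have hwk : w k = v k := if_pos rfl
  have hwj : ∀ j, j ≠ k → ((p ^ m : ℕ) : ℤ) * w j = v j - c j * v k := fun j hj => by
    simp only [w, if_neg hj]
    exact Int.mul_ediv_cancel' (hdvd j hj)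
  have hpm : 0 < p ^ m := pow_pos (Fact.out : p.Prime).pos m
  have hle : ∀ j, (w j).natAbs ≤ q := by
    intro j
    by_cases hj : j = k
    · rw [hj, hwk, h3]
    · have e := congrArg Int.natAbs (hwj j hj)
      rw [Int.natAbs_mul, Int.natAbs_natCast] at e
      have e2 : (v j - c j * v k).natAbs ≤ q + c j * q := by
        refine (Int.natAbs_sub_le _ _).trans ?_
        rw [Int.natAbs_mul, Int.natAbs_natCast, h3]
        exact Nat.add_le_add_right ((natAbs_le_Hsup v j).trans h2.le) _
      refine Nat.le_of_mul_le_mul_left ?_ hpm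
      rw [e]
      refine e2.trans ?_
      calc q + c j * q = (c j + 1) * q := by ring
        _ ≤ p ^ m * q := Nat.mul_le_mul_right q (hc j)
  have hprim : IsPrim w := by
    have hd : Finset.univ.gcd w ∣ Finset.univ.gcd v := by
      refine Finset.dvd_gcd fun j _ => ?_
      have hk : Finset.univ.gcd w ∣ v k := hwk ▸ Finset.gcd_dvd (Finset.mem_univ k)
      by_cases hj : j = k
      · rwa [hj]
      · have : v j = (p ^ m : ℕ) * w j + c j * v k := by rw [hwj j hj]; ring
        rw [this]
        exact dvd_add ((Finset.gcd_dvd (Finset.mem_univ j)).mul_left _) (hk.mul_left _)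
    exact h1.of_gcd_dvd hd
  have himg : shearEquiv k (fun j => (c j : ℚ_[p])) _ hP (intPadic p v) = intPadic p w := by
    ext j
    by_cases hj : j = k
    · rw [hj, shearEquiv_apply_same]
      simp [intPadic, hwk]
    · rw [shearEquiv_apply_of_ne hj, ← hcast, ← hwj j hj]
      push_cast
      rw [← mul_assoc, inv_mul_cancel₀ hP, one_mul, intPadic]
  refine ⟨hq, w, u, hprim, Hsup_eq_of_forall_le (by rw [hwk, h3]) hle, by rw [hwk, h3], h4, ?_⟩
  rw [← himg, ← map_smul, ← map_sub]
  exact (norm_shearEquiv_le k (fun j => norm_natCast_le_one _) hP _).trans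
    (mul_le_mul_of_nonneg_left h5 (by positivity))

/-- A limsup set is at least as dense in the whole chart as in any small ball about one of its
points. -/
theorem padicHaar_chartLimsup_density {k : Fin n} {ψ : ℕ → ℝ} (hψ : ∀ q, 0 ≤ ψ q)
    (hψ0 : Tendsto ψ atTop (𝓝 0)) {x : Fin n → ℚ_[p]} (hx : x ∈ unitChart p k) {m : ℕ}
    (hm : m ≠ 0) :
    padicHaar p n (chartLimsup p k ψ ∩ Metric.closedBall x ((p : ℝ) ^ (-(m : ℤ)))) *
        padicHaar p n (unitChart p k) ≤
      padicHaar p n (chartLimsup p k ψ ∩ unitChart p k) *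
        padicHaar p n (Metric.closedBall x ((p : ℝ) ^ (-(m : ℤ)))) := by
  set L := chartLimsup p k ψ with hL
  set B := Metric.closedBall x ((p : ℝ) ^ (-(m : ℤ))) with hB
  have hk0 : x k ≠ 0 := norm_ne_zero_iff.mp (by rw [hx.1]; exact one_ne_zero)
  have hP : (p : ℚ_[p]) ^ m ≠ 0 := pow_ne_zero m prime_cast_ne_zero
  have hdiv : ∀ j, ‖x j / x k‖ ≤ 1 := fun j => by
    rw [norm_div, hx.1, div_one]
    exact (norm_le_pi_norm x j).trans hx.2
  choose c hc hxc using fun j => exists_natCast_norm_sub_le (hdiv j) m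
  have hxc' : ∀ j, ‖x j - c j * x k‖ ≤ (p : ℝ) ^ (-(m : ℤ)) := fun j => by
    have : x j - c j * x k = (x j / x k - c j) * x k := by field_simp
    rw [this, norm_mul, hx.1, mul_one]
    exact hxc j
  have hcm : ∀ j (z : ℚ_[p]) {r : ℝ}, ‖z‖ ≤ r → ‖(c j : ℚ_[p]) * z‖ ≤ r := fun j z r h => by
    rw [norm_mul]
    exact (mul_le_of_le_one_left (norm_nonneg _) (norm_natCast_le_one _)).trans h
  have hBmem : ∀ z ∈ B, ∀ j, ‖z j - x j‖ ≤ (p : ℝ) ^ (-(m : ℤ)) := fun z hz j =>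
    (norm_le_pi_norm (z - x) j).trans (mem_closedBall_iff_norm.mp hz)
  have hBc : ∀ z ∈ B, ∀ j, ‖z j - c j * z k‖ ≤ (p : ℝ) ^ (-(m : ℤ)) := fun z hz j => by
    have : z j - c j * z k = (z j - x j) - (c j * (z k - x k) - (x j - c j * x k)) := by ring
    rw [this]
    exact (norm_sub_le_max_ultra _ _).trans (max_le (hBmem z hz j)
      ((norm_sub_le_max_ultra _ _).trans (max_le (hcm j _ (hBmem z hz k)) (hxc' j))))
  set g := shearEquiv k (fun j => (c j : ℚ_[p])) _ hP with hg
  have hgB : g '' B = slab p k (x k) m := by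
    ext w
    constructor
    · rintro ⟨z, hz, rfl⟩
      refine ⟨?_, fun j hj => ?_⟩
      · rw [hg, shearEquiv_apply_same]
        exact hBmem z hz k
      · rw [hg, shearEquiv_apply_of_ne hj, norm_inv_pow_mul_le_one_iff]
        exact hBc z hz j
    · rintro ⟨hw1, hw2⟩
      refine ⟨g.symm w, ?_, g.apply_symm_apply w⟩
      set z := g.symm w
      have hwz : w = g z := (g.apply_symm_apply w).symm
      have hzk : w k = z k := by rw [hwz, hg, shearEquiv_apply_same]
      rw [hzk] at hw1
      rw [hB, mem_closedBall_iff_norm, pi_norm_le_iff_of_nonneg (zpow_neg_pos m).le]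
      intro j
      by_cases hj : j = k
      · rw [hj]
        exact hw1
      · have h := hw2 j hj
        rw [hwz, hg, shearEquiv_apply_of_ne hj, norm_inv_pow_mul_le_one_iff] at h
        have : (z - x) j = (z j - c j * z k) - ((x j - c j * x k) - c j * (z k - x k)) := by
          rw [Pi.sub_apply]
          ring
        rw [this]
        exact (norm_sub_le_max_ultra _ _).trans (max_le h
          ((norm_sub_le_max_ultra _ _).trans (max_le (hxc' j) (hcm j _ hw1))))
  have hgL : g '' (L ∩ B) ⊆ chartLimsup p k (fun q => (p : ℝ) ^ m * ψ q) ∩ slab p k (x k) m := by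
    rintro _ ⟨z, ⟨hzL, hzB⟩, rfl⟩
    exact ⟨shearEquiv_mem_chartLimsup hψ hψ0 hc hP hzL fun j _ => hBc z hzB j,
      hgB ▸ Set.mem_image_of_mem g hzB⟩
  obtain ⟨C, hC⟩ := exists_padicHaar_image g
  have h1 : C * padicHaar p n (L ∩ B) ≤ padicHaar p n (L ∩ slab p k (x k) m) := by
    rw [← hC]
    refine (measure_mono hgL).trans_eq (measure_congr ?_)
    exact (chartLimsup_const_mul_ae_eq k hψ0
      (pow_pos (by exact_mod_cast (Fact.out : p.Prime).pos) m)).inter (ae_eq_refl _)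
  have h2 : padicHaar p n (slab p k (x k) m) = C * padicHaar p n B := by rw [← hgB, hC]
  have h3 := padicHaar_inter_unitChart (measurableSet_chartLimsup k ψ)
    (fun u hu y hy => smul_mem_chartLimsup hψ hu hy) k hx.1 hm
  have h4 := padicHaar_inter_unitChart (p := p) (n := n) MeasurableSet.univ
    (fun _ _ _ _ => Set.mem_univ _) k hx.1 hm
  rw [Set.univ_inter, Set.univ_inter, h2] at h4
  rw [h3, h4]
  calc _ = ((Finset.range (p ^ m)).filter (¬ p ∣ ·)).card *
        (C * padicHaar p n (L ∩ B)) * padicHaar p n B := by ring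
    _ ≤ _ := by gcongr

/-- In each chart, the limsup set is null or has null complement. -/
theorem padicHaar_chart_zero_one {k : Fin n} {ψ : ℕ → ℝ} (hψ : ∀ q, 0 ≤ ψ q)
    (hψ0 : Tendsto ψ atTop (𝓝 0)) (hL : padicHaar p n (chartLimsup p k ψ) ≠ 0) :
    padicHaar p n (unitChart p k \ chartLimsup p k ψ) = 0 := by
  obtain ⟨x, hxL, hx⟩ := Measure.exists_mem_of_measure_ne_zero_of_ae hL
    (IsUnifLocDoublingMeasure.ae_tendsto_measure_inter_div (padicHaar p n) (chartLimsup p k ψ) 1)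
  have hsub := chartLimsup_subset_unitChart hψ hψ0 (p := p) (k := k)
  have hlim := hx (fun _ : ℕ => x) (fun m : ℕ => (p : ℝ) ^ (-(m : ℤ))) tendsto_zpow_neg
    (Eventually.of_forall fun m => Metric.mem_closedBall_self
      (by rw [one_mul]; exact (zpow_neg_pos m).le))
  have hSfin : padicHaar p n (unitChart p k) ≠ ⊤ := by
    refine ne_top_of_le_ne_top ENNReal.one_ne_top
      ((measure_mono fun y hy => ?_).trans_eq padicHaar_unitBall)
    exact fun i => (norm_le_pi_norm y i).trans hy.2
  have hle : padicHaar p n (unitChart p k) ≤ padicHaar p n (chartLimsup p k ψ) := by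
    have hlim2 := ENNReal.Tendsto.mul_const (b := padicHaar p n (unitChart p k)) hlim
      (Or.inr hSfin)
    rw [one_mul] at hlim2
    refine le_of_tendsto hlim2 ((eventually_ne_atTop 0).mono fun m hm => ?_)
    have hd := padicHaar_chartLimsup_density hψ hψ0 (hsub hxL) hm
    rw [Set.inter_eq_left.mpr hsub] at hd
    rw [div_eq_mul_inv, mul_right_comm, ← div_eq_mul_inv]
    exact ENNReal.div_le_of_le_mul hd
  rw [measure_sdiff hsub (measurableSet_chartLimsup k ψ).nullMeasurableSet
    (ne_top_of_le_ne_top hSfin (measure_mono hsub))]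
  exact tsub_eq_zero_of_le hle

/-- Whether the limsup set is null does not depend on the chart. -/
theorem padicHaar_chartLimsup_eq_zero {k l : Fin n} {ψ : ℕ → ℝ} (hψ : ∀ q, 0 ≤ ψ q)
    (hk : padicHaar p n (chartLimsup p k ψ) = 0) : padicHaar p n (chartLimsup p l ψ) = 0 := by
  let σ := LinearEquiv.funCongrLeft ℚ_[p] ℚ_[p] (Equiv.swap k l)
  have hσ : ∀ x : Fin n → ℚ_[p], σ (σ x) = x := fun x => by
    ext i
    simp [σ, LinearEquiv.funCongrLeft_apply, LinearMap.funLeft_apply]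
  have hσn : ∀ x : Fin n → ℚ_[p], ‖σ x‖ ≤ ‖x‖ := fun x =>
    (pi_norm_le_iff_of_nonneg (norm_nonneg x)).mpr fun i => norm_le_pi_norm x _
  obtain ⟨C, hC⟩ := exists_padicHaar_image σ
  refine measure_mono_null (t := σ '' chartLimsup p k ψ) (fun x hx => ⟨σ x, ?_, hσ x⟩)
    (by rw [hC, hk, mul_zero])
  rw [mem_chartLimsup hψ] at hx ⊢
  refine hx.mono ?_
  rintro q ⟨hq, v, u, h1, h2, h3, h4, h5⟩
  refine ⟨hq, v ∘ Equiv.swap k l, u, ?_, ?_, ?_, h4, ?_⟩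
  · have hd : Finset.univ.gcd (v ∘ Equiv.swap k l) ∣ Finset.univ.gcd v := by
      refine Finset.dvd_gcd fun j _ => ?_
      have := Finset.gcd_dvd (f := v ∘ Equiv.swap k l) (Finset.mem_univ (Equiv.swap k l j))
      simpa using this
    exact h1.of_gcd_dvd hd
  · exact Hsup_eq_of_forall_le (k := k) (by simpa using h3)
      fun i => (natAbs_le_Hsup v _).trans_eq h2
  · simpa using h3
  · have : σ x - u • intPadic p (v ∘ Equiv.swap k l) = σ (x - u • intPadic p v) := by
      ext i
      simp [σ, LinearEquiv.funCongrLeft_apply, LinearMap.funLeft_apply, intPadic]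
    rw [this]
    exact (hσn _).trans h5

end Charts

section Projective

variable {p : ℕ} [Fact p.Prime] {n : ℕ}

theorem exists_norm_apply_eq (hn : n ≠ 0) (x : Fin n → ℚ_[p]) : ∃ k, ‖x k‖ = ‖x‖ := by
  have : Nonempty (Fin n) := ⟨⟨0, Nat.pos_of_ne_zero hn⟩⟩
  obtain ⟨k, hk⟩ := Finite.exists_max fun i => ‖x i‖
  exact ⟨k, le_antisymm (norm_le_pi_norm x k)
    ((pi_norm_le_iff_of_nonneg (norm_nonneg _)).mpr hk)⟩

theorem intPadic_ne_zero {v : Fin n → ℤ} (hv : intRat v ≠ 0) : intPadic p v ≠ 0 := by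
  refine fun h => hv (funext fun i => ?_)
  have := congrFun h i
  simpa [intPadic, intRat] using this

/-- A point of `p`-adic projective space is at distance zero from at most one rational point. -/
theorem mk_eq_mk_of_padicDelta_le_zero {x : Fin n → ℚ_[p]} (hx : x ≠ 0) {v w : Fin n → ℤ}
    (hv : intRat v ≠ 0) (hw : intRat w ≠ 0) (hxv : padicDelta p x (intPadic p v) ≤ 0)
    (hxw : padicDelta p x (intPadic p w) ≤ 0) :
    Projectivization.mk ℚ (intRat v) hv = Projectivization.mk ℚ (intRat w) hw := by
  rw [padicDelta_le_iff hx (intPadic_ne_zero hv) le_rfl] at hxv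
  rw [padicDelta_le_iff hx (intPadic_ne_zero hw) le_rfl] at hxw
  simp only [zero_mul, norm_le_zero_iff, sub_eq_zero] at hxv hxw
  obtain ⟨i, hi⟩ := Function.ne_iff.mp hx
  have hi' : x i ≠ 0 := hi
  have hcross : ∀ a b, v a * w b = v b * w a := fun a b => by
    have h : x i * x i * (intPadic p v a * intPadic p w b)
        = x i * x i * (intPadic p v b * intPadic p w a) := by
      linear_combination (x i * intPadic p w b) * hxv i a + (x a * intPadic p v i) * hxw i b
        - (x i * intPadic p w a) * hxv i b - (x b * intPadic p v i) * hxw i a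
    have h2 := mul_left_cancel₀ (mul_ne_zero hi' hi') h
    simp only [intPadic] at h2
    exact_mod_cast h2
  obtain ⟨b, hb⟩ := Function.ne_iff.mp hw
  have hb' : (w b : ℚ) ≠ 0 := hb
  refine (Projectivization.mk_eq_mk_iff' ℚ _ _ _ _).mpr ⟨v b / w b, funext fun a => ?_⟩
  have h3 : (v a : ℚ) * w b = v b * w a := by exact_mod_cast hcross a b
  simp only [intRat, Pi.smul_apply, smul_eq_mul]
  rw [div_mul_eq_mul_div, div_eq_iff hb', h3]

theorem mk_mem_Wp_iff {ψ : ℕ → ℝ} (hψ0 : ∀ q, p ∣ q → ψ q = 0) {x : Fin n → ℚ_[p]}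
    (hx : x ≠ 0) :
    Projectivization.mk ℚ_[p] x hx ∈ Wp p n ψ ↔ ∃ᶠ q in atTop, ¬ p ∣ q ∧
      ∃ v : Fin n → ℤ, IsPrim v ∧ Hsup v = q ∧ padicDelta p x (intPadic p v) ≤ ψ q := by
  rw [Nat.frequently_atTop_iff_infinite, Wp, Set.mem_ofPred_eq]
  simp only [padicDelta_rep_mk]
  constructor
  · refine fun h hQ => h ?_
    have hfin : ∀ q, {y : Projectivization ℚ (Fin n → ℚ) | ∃ v : Fin n → ℤ, Hsup v = q ∧
        ∃ hv : intRat v ≠ 0, y = Projectivization.mk ℚ (intRat v) hv}.Finite := fun q => by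
      refine (((finite_setOf_Hsup_eq q).preimage Subtype.val_injective.injOn).image
        (fun v : {v : Fin n → ℤ // intRat v ≠ 0} =>
          Projectivization.mk ℚ (intRat v.1) v.2)).subset ?_
      rintro y ⟨v, hvq, hv, rfl⟩
      exact ⟨⟨v, hv⟩, hvq, rfl⟩
    have hsub : {y : Projectivization ℚ (Fin n → ℚ) | ∃ v : Fin n → ℤ,
        padicDelta p x (intPadic p v) ≤ 0 ∧
        ∃ hv : intRat v ≠ 0, y = Projectivization.mk ℚ (intRat v) hv}.Subsingleton := by
      rintro _ ⟨v, hxv, hv, rfl⟩ _ ⟨w, hxw, hw, rfl⟩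
      exact mk_eq_mk_of_padicDelta_le_zero hx hv hw hxv hxw
    refine (hsub.finite.union (hQ.biUnion fun q _ => hfin q)).subset ?_
    rintro y ⟨v, hvp, ⟨hv, hy⟩, hd⟩
    by_cases hq : p ∣ Hsup v
    · rw [hψ0 _ hq] at hd
      exact Or.inl ⟨v, hd, hv, hy⟩
    · exact Or.inr (Set.mem_biUnion (x := Hsup v) ⟨hq, v, hvp, rfl, hd⟩ ⟨v, rfl, hv, hy⟩)
  · intro hQ
    choose! f hf using fun q (hq : q ∈ {q : ℕ | ¬ p ∣ q ∧ ∃ v : Fin n → ℤ, IsPrim v ∧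
      Hsup v = q ∧ padicDelta p x (intPadic p v) ≤ ψ q}) => hq.2
    have : Infinite {q : ℕ | ¬ p ∣ q ∧ ∃ v : Fin n → ℤ, IsPrim v ∧
      Hsup v = q ∧ padicDelta p x (intPadic p v) ≤ ψ q} := hQ.to_subtype
    refine Set.infinite_of_injective_forall_mem (f := fun q : {q : ℕ | ¬ p ∣ q ∧
      ∃ v : Fin n → ℤ, IsPrim v ∧ Hsup v = q ∧ padicDelta p x (intPadic p v) ≤ ψ q} =>
      Projectivization.mk ℚ (intRat (f q)) (hf q q.2).1.intRat_ne_zero) ?_ ?_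
    · intro q r hqr
      have h := (hf q q.2).1.Hsup_eq (hf r r.2).1 hqr
      rw [(hf q q.2).2.1, (hf r r.2).2.1] at h
      exact Subtype.ext h
    · intro q
      obtain ⟨h1, h2, h3⟩ := hf q q.2
      exact ⟨f q, h1, ⟨h1.intRat_ne_zero, rfl⟩, by rwa [h2]⟩

/-- If `ψ` tends to zero, `Wp` restricted to unit vectors is the union of the chart limsup sets. -/
theorem mk_mem_Wp_iff_exists_chartLimsup (hn : n ≠ 0) {ψ : ℕ → ℝ} (hψ : ∀ q, 0 ≤ ψ q)
    (hψ0 : ∀ q, p ∣ q → ψ q = 0) (hlim : Tendsto ψ atTop (𝓝 0)) {x : Fin n → ℚ_[p]}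
    (hx : x ≠ 0) (hx1 : ‖x‖ = 1) :
    Projectivization.mk ℚ_[p] x hx ∈ Wp p n ψ ↔ ∃ k, x ∈ chartLimsup p k ψ := by
  have key : ∀ {q : ℕ} {v : Fin n → ℤ} {k : Fin n}, ¬ p ∣ q → (v k).natAbs = q → ψ q < 1 →
      (padicDelta p x (intPadic p v) ≤ ψ q ↔
        ∃ u : ℚ_[p], ‖u‖ = 1 ∧ ‖x - u • intPadic p v‖ ≤ ψ q) := by
    intro q v k hq hk hq1
    have hvk : ¬ p ∣ (v k).natAbs := by rwa [hk]
    exact padicDelta_le_iff_exists_unit hx1 (norm_intPadic_eq_one hvk)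
      (norm_intPadic_apply_eq_one hvk) (hψ q) hq1
  have hev : ∀ᶠ q in atTop, ψ q < 1 := hlim.eventually_lt_const zero_lt_one
  rw [mk_mem_Wp_iff hψ0]
  simp only [mem_chartLimsup hψ]
  constructor
  · intro h
    by_contra hcon
    rw [not_exists] at hcon
    have hall : ∀ᶠ q in atTop, ∀ k : Fin n, ¬ (¬ p ∣ q ∧ ∃ (v : Fin n → ℤ) (u : ℚ_[p]),
        IsPrim v ∧ Hsup v = q ∧ (v k).natAbs = q ∧ ‖u‖ = 1 ∧ ‖x - u • intPadic p v‖ ≤ ψ q) :=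
      eventually_all.mpr fun k => not_frequently.mp (hcon k)
    obtain ⟨q, ⟨hq, v, hv, hvq, hd⟩, hq1, hno⟩ := (h.and_eventually (hev.and hall)).exists
    obtain ⟨k, hk⟩ := exists_natAbs_eq_Hsup hn v
    rw [hvq] at hk
    obtain ⟨u, hu, hxu⟩ := (key hq hk hq1).mp hd
    exact hno k ⟨hq, v, u, hv, hvq, hk, hu, hxu⟩
  · rintro ⟨k, hk⟩
    refine (hk.and_eventually hev).mono ?_
    rintro q ⟨⟨hq, v, u, hv, hvq, hvk, hu, hxu⟩, hq1⟩
    exact ⟨hq, v, hv, hvq, (key hq hvk hq1).mpr ⟨u, hu, hxu⟩⟩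

/-- Rational points of a given large height prime to `p` are dense in projective space up to
a given scale. -/
theorem exists_isPrim_padicDelta_le (hn : 2 ≤ n) {x : Fin n → ℚ_[p]} (hx : x ≠ 0) (m : ℕ) {q : ℕ}
    (hq : 2 * (p ^ m * primorial (p ^ m)) ≤ q) (hpq : ¬ p ∣ q) :
    ∃ v : Fin n → ℤ, IsPrim v ∧ Hsup v = q ∧
      padicDelta p x (intPadic p v) ≤ (p : ℝ) ^ (-(m : ℤ)) := by
  have hpp : p.Prime := Fact.out
  have hpm : 0 < p ^ m := pow_pos hpp.pos m
  obtain ⟨k, hk⟩ := exists_norm_apply_eq (by omega) x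
  have hnx : ‖x‖ ≠ 0 := norm_ne_zero_iff.mpr hx
  have hxk : x k ≠ 0 := norm_ne_zero_iff.mp (by rwa [hk])
  have : Nontrivial (Fin n) := Fin.nontrivial_iff_two_le.mpr hn
  obtain ⟨l, hl⟩ := exists_ne k
  have hz : ∀ j, ‖x j / x k‖ ≤ 1 := fun j => by
    rw [norm_div, hk]
    exact div_le_one_of_le₀ (norm_le_pi_norm x j) (norm_nonneg x)
  have hqz : ∀ j, ‖(q : ℚ_[p]) * (x j / x k)‖ ≤ 1 := fun j => by
    rw [norm_mul]
    exact mul_le_one₀ (norm_natCast_le_one q) (norm_nonneg _) (hz j)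
  choose c hc hqc using fun j => exists_natCast_norm_sub_le (hqz j) m
  obtain ⟨a, haq, hac, hcop⟩ := exists_coprime_modEq_le hpm hq
    (Nat.Coprime.pow_left m ((Nat.Prime.coprime_iff_not_dvd hpp).mpr hpq)) (c l)
  have hle : p ^ m ≤ q := by
    have := primorial_pos (p ^ m)
    nlinarith
  let v : Fin n → ℤ := fun j => if j = k then q else if j = l then a else c j
  have hvk : v k = q := if_pos rfl
  have hvl : v l = a := by simp [v, hl]
  have hvj : ∀ j, j ≠ k → j ≠ l → v j = c j := fun j h1 h2 => by simp [v, h1, h2]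
  have hvkn : (v k).natAbs = q := by rw [hvk, Int.natAbs_natCast]
  have hH : Hsup v = q := by
    refine Hsup_eq_of_forall_le hvkn fun j => ?_
    by_cases h1 : j = k
    · rw [h1, hvkn]
    · by_cases h2 : j = l
      · rw [h2, hvl, Int.natAbs_natCast]
        exact haq
      · rw [hvj j h1 h2, Int.natAbs_natCast]
        exact (hc j).le.trans hle
  have hnear : ∀ j, ‖(q : ℚ_[p]) * (x j / x k) - intPadic p v j‖ ≤ (p : ℝ) ^ (-(m : ℤ)) := by
    intro j
    by_cases h1 : j = k
    · rw [h1, div_self hxk, mul_one, intPadic, hvk, Int.cast_natCast, sub_self, norm_zero]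
      exact (zpow_neg_pos m).le
    · by_cases h2 : j = l
      · have hd : ‖(((c l : ℤ) - a : ℤ) : ℚ_[p])‖ ≤ (p : ℝ) ^ (-(m : ℤ)) := by
          rw [Padic.norm_int_le_pow_iff_dvd]
          exact_mod_cast (Int.modEq_iff_dvd.mp (Int.natCast_modEq_iff.mpr hac))
        have e : (q : ℚ_[p]) * (x l / x k) - intPadic p v l
            = (q * (x l / x k) - c l) - -(((c l : ℤ) - a : ℤ) : ℚ_[p]) := by
          rw [intPadic, hvl]
          push_cast
          ring
        rw [h2, e]
        exact (norm_sub_le_max_ultra _ _).trans (max_le (hqc l) (by rwa [norm_neg]))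
      · rw [intPadic, hvj j h1 h2, Int.cast_natCast]
        exact hqc j
  have hprim : IsPrim v := by
    have h1 : Finset.univ.gcd v ∣ (q : ℤ) := hvk ▸ Finset.gcd_dvd (Finset.mem_univ k)
    have h2 : Finset.univ.gcd v ∣ (a : ℤ) := hvl ▸ Finset.gcd_dvd (Finset.mem_univ l)
    rw [IsPrim, ← Finset.normalize_gcd]
    exact normalize_eq_one.mpr
      (IsCoprime.isUnit_of_dvd' (Nat.isCoprime_iff_coprime.mpr hcop) h2 h1)
  have hvkp : ¬ p ∣ (v k).natAbs := by rwa [hvkn]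
  have hy : ‖intPadic p v‖ = 1 := norm_intPadic_eq_one hvkp
  have hy0 : intPadic p v ≠ 0 := norm_ne_zero_iff.mp (by rw [hy]; exact one_ne_zero)
  refine ⟨v, hprim, hH, (padicDelta_le_iff hx hy0 (zpow_neg_pos m).le).mpr fun i j => ?_⟩
  have e : x i * intPadic p v j - x j * intPadic p v i = x k *
      ((x j / x k) * (q * (x i / x k) - intPadic p v i)
        - (x i / x k) * (q * (x j / x k) - intPadic p v j)) := by
    field_simp
    ring
  rw [e, hy, mul_one, norm_mul, hk, mul_comm]
  refine mul_le_mul_of_nonneg_right ?_ (norm_nonneg x)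
  refine (norm_sub_le_max_ultra _ _).trans (max_le ?_ ?_) <;> rw [norm_mul]
  · exact (mul_le_of_le_one_left (norm_nonneg _) (hz j)).trans (hnear i)
  · exact (mul_le_of_le_one_left (norm_nonneg _) (hz i)).trans (hnear j)

/-- If `ψ` does not tend to zero, every point is approximable. -/
theorem Wp_eq_univ (hn : 2 ≤ n) {ψ : ℕ → ℝ} (hψ : ∀ q, 0 ≤ ψ q)
    (hψ0 : ∀ q, p ∣ q → ψ q = 0) (hlim : ¬ Tendsto ψ atTop (𝓝 0)) : Wp p n ψ = Set.univ := by
  obtain ⟨ε, hε, hfreq⟩ : ∃ ε > 0, ∃ᶠ q in atTop, ε ≤ ψ q := by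
    by_contra! hcon
    refine hlim (Metric.tendsto_nhds.mpr fun ε hε => ?_)
    refine (hcon ε hε).mono fun q hq => ?_
    rw [Real.dist_0_eq_abs, abs_of_nonneg (hψ q)]
    exact hq
  obtain ⟨m, hm⟩ : ∃ m : ℕ, (p : ℝ) ^ (-(m : ℤ)) ≤ ε :=
    ((tendsto_nhdsWithin_iff.mp (tendsto_zpow_neg (p := p))).1.eventually_le_const hε).exists
  refine Set.eq_univ_of_forall fun y => ?_
  rw [← y.mk_rep, mk_mem_Wp_iff hψ0]
  refine (hfreq.and_eventually
    (eventually_ge_atTop (2 * (p ^ m * primorial (p ^ m))))).mono ?_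
  rintro q ⟨hq1, hq2⟩
  have hpq : ¬ p ∣ q := fun h => absurd (hψ0 q h) (hε.trans_le hq1).ne'
  obtain ⟨v, h1, h2, h3⟩ := exists_isPrim_padicDelta_le hn y.rep_nonzero m hq2 hpq
  exact ⟨hpq, v, h1, h2, h3.trans (hm.trans hq1)⟩

/-- A cone is null as soon as its trace on the unit sphere is null. -/
theorem padicHaar_cone_eq_zero (hn : n ≠ 0) {E : Set (Fin n → ℚ_[p])} (hE0 : 0 ∉ E)
    (hE : ∀ a : ℚ_[p], a ≠ 0 → ∀ x ∈ E, a • x ∈ E)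
    (hnull : padicHaar p n (E ∩ {x | ‖x‖ = 1}) = 0) : padicHaar p n E = 0 := by
  have hp0 : ∀ j : ℤ, (p : ℚ_[p]) ^ j ≠ 0 := fun j => zpow_ne_zero j prime_cast_ne_zero
  refine measure_mono_null (t := ⋃ j : ℤ,
    scaleEquiv n _ (hp0 j) '' (E ∩ {x | ‖x‖ = 1})) (fun x hx => ?_) (measure_iUnion_null fun j => ?_)
  · have hx0 : x ≠ 0 := fun h => hE0 (h ▸ hx)
    obtain ⟨k, hk⟩ := exists_norm_apply_eq hn x
    have hxk : x k ≠ 0 := norm_ne_zero_iff.mp (by rwa [hk, norm_ne_zero_iff])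
    have hpos : (p : ℝ) ≠ 0 := by exact_mod_cast (Fact.out : p.Prime).ne_zero
    refine Set.mem_iUnion.mpr ⟨(x k).valuation, ((p : ℚ_[p]) ^ (x k).valuation)⁻¹ • x,
      ⟨hE _ (inv_ne_zero (hp0 _)) x hx, ?_⟩, ?_⟩
    · rw [Set.mem_ofPred_eq, norm_smul, ← hk, norm_inv, Padic.norm_p_zpow,
        Padic.norm_eq_zpow_neg_valuation hxk, inv_mul_cancel₀ (zpow_ne_zero _ hpos)]
    · rw [scaleEquiv_apply, smul_smul, mul_inv_cancel₀ (hp0 _), one_smul]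
  · obtain ⟨C, hC⟩ := exists_padicHaar_image (scaleEquiv n _ (hp0 j))
    rw [hC, hnull, mul_zero]

theorem mk_smul_eq {a : ℚ_[p]} {x : Fin n → ℚ_[p]} (hx : x ≠ 0) (hax : a • x ≠ 0) :
    Projectivization.mk ℚ_[p] (a • x) hax = Projectivization.mk ℚ_[p] x hx :=
  (Projectivization.mk_eq_mk_iff' ℚ_[p] _ _ _ _).mpr ⟨a, rfl⟩

theorem muP_eq_zero (hn : n ≠ 0) {M : Set (Projectivization ℚ_[p] (Fin n → ℚ_[p]))}
    (h : padicHaar p n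
      ({x | ∃ hx : x ≠ 0, Projectivization.mk ℚ_[p] x hx ∈ M} ∩ {x | ‖x‖ = 1}) = 0) :
    muP p n M = 0 := by
  refine measure_mono_null (fun x hx => hx.2) (padicHaar_cone_eq_zero hn ?_ ?_ h)
  · rintro ⟨h0, -⟩
    exact h0 rfl
  · rintro a ha x ⟨hx, hxM⟩
    exact ⟨smul_ne_zero ha hx, by rwa [mk_smul_eq hx]⟩

theorem muP_eq_one (hn : n ≠ 0) {M : Set (Projectivization ℚ_[p] (Fin n → ℚ_[p]))}
    (h : padicHaar p n
      ({x | ∃ hx : x ≠ 0, Projectivization.mk ℚ_[p] x hx ∉ M} ∩ {x | ‖x‖ = 1}) = 0) :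
    muP p n M = 1 := by
  have hcompl : padicHaar p n {x | ∃ hx : x ≠ 0, Projectivization.mk ℚ_[p] x hx ∉ M} = 0 := by
    refine padicHaar_cone_eq_zero hn ?_ ?_ h
    · rintro ⟨h0, -⟩
      exact h0 rfl
    · rintro a ha x ⟨hx, hxM⟩
      exact ⟨smul_ne_zero ha hx, by rwa [mk_smul_eq hx]⟩
  rw [← padicHaar_unitBall (p := p) (n := n)]
  refine le_antisymm (measure_mono fun x hx => hx.1) ?_
  have hcover : {x : Fin n → ℚ_[p] | ∀ i, ‖x i‖ ≤ 1} ⊆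
      {x | (∀ i, ‖x i‖ ≤ 1) ∧ ∃ hx : x ≠ 0, Projectivization.mk ℚ_[p] x hx ∈ M} ∪
      ({x | ∃ hx : x ≠ 0, Projectivization.mk ℚ_[p] x hx ∉ M} ∪ {0}) := by
    intro x hx
    by_cases h0 : x = 0
    · exact Or.inr (Or.inr h0)
    · by_cases hM : Projectivization.mk ℚ_[p] x h0 ∈ M
      · exact Or.inl ⟨hx, h0, hM⟩
      · exact Or.inr (Or.inl ⟨h0, hM⟩)
  refine (measure_mono hcover).trans ((measure_union_le _ _).trans_eq ?_)
  rw [measure_union_null hcompl (padicHaar_singleton hn 0), add_zero, muP]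

end Projective

/-- the zero-one law for projective `p`-adic approximation. -/
theorem projective_zero_one_law (n p : ℕ) (hn : 2 ≤ n) [Fact p.Prime]
    (ψ : ℕ → ℝ) (hψ : ∀ q, 0 ≤ ψ q) (hψ0 : ∀ q, p ∣ q → ψ q = 0) :
    muP p n (Wp p n ψ) = 0 ∨ muP p n (Wp p n ψ) = 1 := by
  have hn0 : n ≠ 0 := by omega
  by_cases hlim : Tendsto ψ atTop (𝓝 0)
  · by_cases hnull : ∀ k : Fin n, padicHaar p n (chartLimsup p k ψ) = 0
    · refine Or.inl (muP_eq_zero hn0 (measure_mono_null ?_ (measure_iUnion_null hnull)))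
      rintro x ⟨⟨hx, hxW⟩, hx1⟩
      exact Set.mem_iUnion.mpr
        ((mk_mem_Wp_iff_exists_chartLimsup hn0 hψ hψ0 hlim hx hx1).mp hxW)
    · obtain ⟨k, hk⟩ := not_forall.mp hnull
      have hfull : ∀ l : Fin n, padicHaar p n (unitChart p l \ chartLimsup p l ψ) = 0 :=
        fun l => padicHaar_chart_zero_one hψ hlim
          (mt (padicHaar_chartLimsup_eq_zero (l := k) hψ) hk)
      refine Or.inr (muP_eq_one hn0 (measure_mono_null ?_ (measure_iUnion_null hfull)))
      rintro x ⟨⟨hx, hxW⟩, hx1⟩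
      have hx1' : ‖x‖ = 1 := hx1
      obtain ⟨l, hl⟩ := exists_norm_apply_eq hn0 x
      exact Set.mem_iUnion.mpr ⟨l, ⟨hl.trans hx1', hx1'.le⟩, fun hxl =>
        hxW ((mk_mem_Wp_iff_exists_chartLimsup hn0 hψ hψ0 hlim hx hx1).mpr ⟨l, hxl⟩)⟩
  · refine Or.inr (muP_eq_one hn0 ?_)
    rw [Wp_eq_univ hn hψ hψ0 hlim]
    simp
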